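/- Let G be a discrete group, let T be a transversal for FC(G) in G, let I be a weak*-closed two-sided ideal of ℓ¹(G), and set J = I ∩ ℓ¹(FC(G)). Then J is a weak*-closed two-sided ideal of ℓ¹(FC(G)) satisfying δ_s * J * δ_{s⁻¹} = J for all s ∈ G, and I = ⊕_{t∈T} δ_t * J; that is, I = {f ∈ ℓ¹(G) : the restriction of δ_{t⁻¹} * f to FC(G) belongs to J for every t ∈ T}. -/

import Mathlib

noncomputable section

open Filter Topology
open scoped Classical ENNReal

/-- Membership in `ℓ¹(G)`: absolutely summable complex-valued functions on `G`. -/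
def MemL1 {G : Type*} (f : G → ℂ) : Prop := Summable fun t => ‖f t‖

/-- Convolution of two functions on a group. -/
def convFn {G : Type*} [Group G] (f g : G → ℂ) : G → ℂ := fun x => ∑' s : G, f s * g (s⁻¹ * x)

/-- `ℓ¹(G)` as a type. -/
def L1 (G : Type*) : Type _ := {f : G → ℂ // MemL1 f}

/-- The predicate of belonging to `c₀(G)`: functions vanishing at infinity on the
discrete group `G`. -/
def MemC0 {G : Type*} (φ : G → ℂ) : Prop := Tendsto φ cofinite (𝓝 0)

/-- The weak*-topology `σ(ℓ¹(G), c₀(G))` on `ℓ¹(G)`, induced by the pairings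
`f ↦ Σ_{t∈G} φ(t) f(t)` with `φ ∈ c₀(G)`. -/
instance L1.topology (G : Type*) : TopologicalSpace (L1 G) :=
  TopologicalSpace.induced
    (fun f : L1 G => fun φ : {φ : G → ℂ // MemC0 φ} => ∑' t : G, φ.1 t * f.1 t)
    inferInstance

/-- A set of elements of `ℓ¹(G)` is weak*-closed. -/
def WStarClosed {G : Type*} (S : Set (G → ℂ)) : Prop := IsClosed {f : L1 G | f.1 ∈ S}

/-- A weak*-closed two-sided ideal of the convolution algebra `ℓ¹(G)`. -/
def IsWStarClosedIdeal {G : Type*} [Group G] (S : Set (G → ℂ)) : Prop :=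
  S ⊆ {f | MemL1 f} ∧ (0 : G → ℂ) ∈ S ∧
  (∀ f ∈ S, ∀ g ∈ S, f + g ∈ S) ∧
  (∀ (c : ℂ), ∀ f ∈ S, c • f ∈ S) ∧
  (∀ f ∈ S, ∀ g : G → ℂ, MemL1 g → convFn g f ∈ S ∧ convFn f g ∈ S) ∧
  WStarClosed S

/-- The point mass `δ_t ∈ ℓ¹(G)`. -/
def delta {G : Type*} (t : G) : G → ℂ := fun x => if x = t then 1 else 0

/-- `f` is supported in the subset `N` of `G`. -/
def SuppIn {G : Type*} (N : Set G) (f : G → ℂ) : Prop := ∀ x, x ∉ N → f x = 0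

/-- `ℓ¹(N)`, identified with the subalgebra of `ℓ¹(G)` of functions supported on `N`. -/
def L1On {G : Type*} (N : Set G) : Set (G → ℂ) := {f | MemL1 f ∧ SuppIn N f}

/-- A two-sided ideal of `ℓ¹(N)` (identified with the functions in `ℓ¹(G)` supported
on `N`). -/
def IsIdealOn {G : Type*} [Group G] (N : Set G) (J : Set (G → ℂ)) : Prop :=
  J ⊆ L1On N ∧ (0 : G → ℂ) ∈ J ∧
  (∀ f ∈ J, ∀ g ∈ J, f + g ∈ J) ∧
  (∀ (c : ℂ), ∀ f ∈ J, c • f ∈ J) ∧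
  (∀ f ∈ J, ∀ g ∈ L1On N, convFn g f ∈ J ∧ convFn f g ∈ J)

/-- The conjugate `f^s = δ_s * f * δ_{s⁻¹}` of `f ∈ ℓ¹(G)` by `s ∈ G`,
so that `f^s (g) = f (s⁻¹ g s)`. -/
def conjFn {G : Type*} [Group G] (s : G) (f : G → ℂ) : G → ℂ := fun g => f (s⁻¹ * g * s)

/-- `J` is invariant under conjugation by elements of `G`:
`δ_s * J * δ_{s⁻¹} = J` for all `s ∈ G`. -/
def GConjInvariant {G : Type*} [Group G] (J : Set (G → ℂ)) : Prop :=
  ∀ s : G, conjFn s '' J = J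

/-- `T` is a transversal (set of coset representatives) for `N` in `G`. -/
def IsTransversal {G : Type*} [Group G] (N : Set G) (T : Set G) : Prop :=
  ∀ g : G, ∃! t : G, t ∈ T ∧ t⁻¹ * g ∈ N

/-- The set `⊕_{t ∈ T} δ_t * J`: those `f ∈ ℓ¹(G)` such that for every `t ∈ T` the
restriction of `δ_{t⁻¹} * f` to `N` belongs to `J`. -/
def bigOplus {G : Type*} [Group G] (N T : Set G) (J : Set (G → ℂ)) : Set (G → ℂ) :=
  {f | MemL1 f ∧ ∀ t ∈ T, N.indicator (convFn (delta t⁻¹) f) ∈ J}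

/-- The FC-centre of `G`: the set of elements with finite conjugacy class. -/
def FCset (G : Type*) [Group G] : Set G := {t : G | {x : G | IsConj t x}.Finite}

open scoped Pointwise

section WeakStar

variable {G : Type*}

theorem MemC0.exists_bound {φ : G → ℂ} (hφ : MemC0 φ) : ∃ C, ∀ t, ‖φ t‖ ≤ C := by
  obtain ⟨C, hC⟩ := (Tendsto.norm hφ).bddAbove_range_of_cofinite
  exact ⟨C, fun t => hC ⟨t, rfl⟩⟩

theorem memC0_delta (x : G) : MemC0 (delta x) := by
  refine tendsto_const_nhds.congr' ?_
  filter_upwards [(Set.finite_singleton x).compl_mem_cofinite] with t ht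
  exact (if_neg ht).symm

theorem memL1_delta (x : G) : MemL1 (delta x) :=
  summable_of_ne_finset_zero (s := {x}) fun t ht => by
    simp [delta, Finset.notMem_singleton.mp ht]

theorem MemL1.indicator {f : G → ℂ} (hf : MemL1 f) (A : Set G) : MemL1 (A.indicator f) :=
  Summable.of_nonneg_of_le (fun _ => norm_nonneg _) (fun t => norm_indicator_le_norm_self f t) hf

/-- Weak*-closed sets are closed under limits along arbitrary filters. -/
theorem WStarClosed.mem_of_tendsto {S : Set (G → ℂ)} (hS : WStarClosed S) {ι : Type*}
    {l : Filter ι} [l.NeBot] {f : ι → G → ℂ} (hf : ∀ i, f i ∈ S) (hf1 : ∀ i, MemL1 (f i))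
    {g : G → ℂ} (hg : MemL1 g)
    (h : ∀ φ, MemC0 φ → Tendsto (fun i => ∑' t, φ t * f i t) l (𝓝 (∑' t, φ t * g t))) :
    g ∈ S := by
  let F : ι → L1 G := fun i => ⟨f i, hf1 i⟩
  let g' : L1 G := ⟨g, hg⟩
  have hind : IsInducing fun f : L1 G => fun φ : {φ : G → ℂ // MemC0 φ} =>
      ∑' t : G, φ.1 t * f.1 t := ⟨rfl⟩
  have key : Tendsto F l (𝓝 g') :=
    hind.tendsto_nhds_iff.mpr (tendsto_pi_nhds.mpr fun φ => h φ.1 φ.2)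
  have hcl : IsClosed {f : L1 G | f.1 ∈ S} := hS
  exact hcl.mem_of_tendsto key (Eventually.of_forall hf)

theorem L1.continuous_eval (x : G) : Continuous fun f : L1 G => f.1 x := by
  have hpair : Continuous fun f : L1 G => fun φ : {φ : G → ℂ // MemC0 φ} =>
      ∑' t : G, φ.1 t * f.1 t := continuous_induced_dom
  have h : Continuous fun f : L1 G => ∑' t, delta x t * f.1 t :=
    continuous_pi_iff.mp hpair ⟨delta x, memC0_delta x⟩
  refine h.congr fun f => ?_
  rw [tsum_eq_single x fun t ht => by simp [delta, ht]]
  simp [delta]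

theorem WStarClosed.inter_L1On {S : Set (G → ℂ)} (hS : WStarClosed S) (N : Set G) :
    WStarClosed (S ∩ L1On N) := by
  have h : IsClosed {f : L1 G | ∀ x, x ∉ N → f.1 x = 0} := by
    simp only [Set.ofPred_forall]
    exact isClosed_iInter fun x => isClosed_iInter fun _ =>
      isClosed_eq (L1.continuous_eval x) continuous_const
  have hSN := IsClosed.inter hS h
  refine (congrArg IsClosed (Set.ext fun f => ?_)).mp hSN
  exact ⟨fun hf => ⟨hf.1, f.2, hf.2⟩, fun hf => ⟨hf.1, hf.2.2⟩⟩

end WeakStar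

section Convolution

variable {G : Type*} [Group G]

theorem convFn_delta_left (s : G) (f : G → ℂ) : convFn (delta s) f = fun x => f (s⁻¹ * x) := by
  ext x
  rw [convFn, tsum_eq_single s fun t ht => by simp [delta, ht]]
  simp [delta]

theorem convFn_delta_right (s : G) (f : G → ℂ) : convFn f (delta s) = fun x => f (x * s⁻¹) := by
  ext x
  rw [convFn, tsum_eq_single (x * s⁻¹) fun t ht => ?_]
  · simp [delta]
  · have : t⁻¹ * x ≠ s := by
      rintro rfl
      simp at ht
    simp [delta, this]

theorem conjFn_eq_convFn (s : G) (f : G → ℂ) :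
    conjFn s f = convFn (delta s) (convFn f (delta s⁻¹)) := by
  simp only [convFn_delta_left, convFn_delta_right, inv_inv]
  rfl

theorem SuppIn.convFn {N : Subgroup G} {f g : G → ℂ} (hf : SuppIn (N : Set G) f)
    (hg : SuppIn (N : Set G) g) : SuppIn (N : Set G) (convFn f g) := by
  intro x hx
  refine (tsum_congr fun s => ?_).trans tsum_zero
  by_cases hs : s ∈ N
  · rw [hg, mul_zero]
    exact fun h => hx (by simpa using N.mul_mem hs h)
  · rw [hf s hs, zero_mul]

theorem IsWStarClosedIdeal.conjFn_mem {I : Set (G → ℂ)} (hI : IsWStarClosedIdeal I) {f : G → ℂ}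
    (hf : f ∈ I) (s : G) : conjFn s f ∈ I := by
  obtain ⟨-, -, -, -, hmul, -⟩ := hI
  rw [conjFn_eq_convFn]
  exact (hmul _ (hmul _ hf _ (memL1_delta _)).2 _ (memL1_delta _)).1

end Convolution

section FCCentre

variable {G : Type*} [Group G]

theorem mem_FCset_iff {g : G} : g ∈ FCset G ↔ (Subgroup.centralizer {g}).FiniteIndex := by
  have horb : {x : G | IsConj g x} = MulAction.orbit (ConjAct G) g := by
    ext x
    rw [ConjAct.mem_orbit_conjAct, isConj_comm]
    rfl
  have hidx : (Subgroup.centralizer {g}).index = {x : G | IsConj g x}.ncard := by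
    rw [horb, ← MulAction.index_stabilizer, Subgroup.centralizer_eq_comap_stabilizer]
    exact Subgroup.index_comap_of_surjective _ ConjAct.toConjAct.surjective
  rw [Subgroup.finiteIndex_iff, hidx]
  refine ⟨fun h => ?_, Set.finite_of_ncard_ne_zero⟩
  rw [Ne, Set.ncard_eq_zero h]
  exact Set.Nonempty.ne_empty ⟨g, IsConj.refl g⟩

/-- The FC-centre as a subgroup. -/
def fcCentre (G : Type*) [Group G] : Subgroup G where
  carrier := FCset G
  one_mem' := by
    rw [mem_FCset_iff]
    have : Subgroup.centralizer {(1 : G)} = ⊤ := by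
      ext; simp [Subgroup.mem_centralizer_singleton_iff]
    rw [this]
    infer_instance
  mul_mem' {a b} ha hb := by
    rw [mem_FCset_iff] at ha hb ⊢
    refine Subgroup.finiteIndex_of_le
      (H := Subgroup.centralizer {a} ⊓ Subgroup.centralizer {b}) fun x hx => ?_
    simp only [Subgroup.mem_inf, Subgroup.mem_centralizer_singleton_iff] at hx ⊢
    exact Commute.mul_right hx.1 hx.2
  inv_mem' {a} ha := by
    rw [mem_FCset_iff] at ha ⊢
    refine Subgroup.finiteIndex_of_le (H := Subgroup.centralizer {a}) fun x hx => ?_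
    simp only [Subgroup.mem_centralizer_singleton_iff] at hx ⊢
    exact Commute.inv_right hx

theorem conj_mem_FCset {g : G} (hg : g ∈ FCset G) (s : G) : s * g * s⁻¹ ∈ FCset G := by
  refine Set.Finite.subset hg fun x hx => ?_
  exact (isConj_iff.mpr ⟨s, rfl⟩ : IsConj g (s * g * s⁻¹)).trans hx

/-- Conjugation can fix finitely many elements of the FC-centre while moving finitely many
elements outside it away from a given finite set. -/
theorem exists_conj_fix_and_escape (F : Finset G) :
    ∃ s : G, ∀ u ∈ F, (u ∈ FCset G → s * u * s⁻¹ = u) ∧ (u ∉ FCset G → s * u * s⁻¹ ∉ F) := by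
  set H : Subgroup G := ⨅ u ∈ F.filter (· ∈ FCset G), Subgroup.centralizer {u} with hH
  have hHfin : H.FiniteIndex :=
    Subgroup.finiteIndex_iInf' _ fun u hu => mem_FCset_iff.mp (Finset.mem_filter.mp hu).2
  by_contra! hcon
  have hbad : ∀ s : H, ∃ u ∈ F, u ∉ FCset G ∧ (s : G) * u * (s : G)⁻¹ ∈ F := by
    intro s
    obtain ⟨u, hu, h⟩ := hcon s
    have hfix : u ∈ FCset G → (s : G) * u * (s : G)⁻¹ = u := by
      intro huN
      have hs : (s : G) ∈ Subgroup.centralizer {u} :=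
        (Subgroup.mem_iInf.mp (Subgroup.mem_iInf.mp s.2 u)) (Finset.mem_filter.mpr ⟨hu, huN⟩)
      rw [Subgroup.mem_centralizer_singleton_iff.mp hs, mul_inv_cancel_right]
    exact ⟨u, hu, h hfix⟩
  have hrep : ∀ p : G × G, ∃ s₀ : H, ∀ s : H, (s : G) * p.1 * (s : G)⁻¹ = p.2 →
      (s₀ : G) * p.1 * (s₀ : G)⁻¹ = p.2 := fun p => by
    by_cases h : ∃ s : H, (s : G) * p.1 * (s : G)⁻¹ = p.2
    · exact ⟨h.choose, fun _ _ => h.choose_spec⟩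
    · exact ⟨1, fun s hs => absurd ⟨s, hs⟩ h⟩
  choose r hr using hrep
  have hcover : ⋃ p ∈ (F ×ˢ F).filter (fun p => p.1 ∉ FCset G),
      r p • (((Subgroup.centralizer {p.1}).subgroupOf H : Subgroup H) : Set H) = Set.univ := by
    refine Set.eq_univ_of_forall fun s => ?_
    obtain ⟨u, hu, huN, hx⟩ := hbad s
    refine Set.mem_biUnion (x := (u, (s : G) * u * (s : G)⁻¹)) (by simp [hu, huN]; simpa using hx) ?_
    rw [mem_leftCoset_iff, SetLike.mem_coe, Subgroup.mem_subgroupOf,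
      Subgroup.mem_centralizer_singleton_iff]
    have h := hr (u, (s : G) * u * (s : G)⁻¹) s rfl
    generalize r (u, (s : G) * u * (s : G)⁻¹) = s₀ at h ⊢
    have h' : (s₀ : G) * u * (s₀ : G)⁻¹ = (s : G) * u * (s : G)⁻¹ := h
    rw [mul_inv_eq_iff_eq_mul] at h'
    push_cast
    rw [mul_assoc, inv_mul_eq_iff_eq_mul, ← mul_assoc, ← mul_assoc, h']
    group
  obtain ⟨p, hp, hfin⟩ := Subgroup.exists_finiteIndex_of_leftCoset_cover hcover
  refine (Finset.mem_filter.mp hp).2 (mem_FCset_iff.mpr ?_)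
  have hinf : (Subgroup.centralizer {p.1} ⊓ H).FiniteIndex := by
    rw [Subgroup.finiteIndex_iff, ← Subgroup.relIndex_mul_index inf_le_right,
      Subgroup.inf_relIndex_right]
    exact mul_ne_zero hfin.index_ne_zero hHfin.index_ne_zero
  exact Subgroup.finiteIndex_of_le (inf_le_left : Subgroup.centralizer {p.1} ⊓ H ≤ _)

end FCCentre

section Ideal

variable {G : Type*} [Group G] {I : Set (G → ℂ)}

/-- A weak*-closed ideal is stable under restriction to the FC-centre. -/
theorem IsWStarClosedIdeal.indicator_FCset_mem (hI : IsWStarClosedIdeal I) {f : G → ℂ}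
    (hf : f ∈ I) : (FCset G).indicator f ∈ I := by
  have hf1 : MemL1 f := hI.1 hf
  choose s hs using exists_conj_fix_and_escape (G := G)
  have hmem : ∀ F, conjFn (s F) f ∈ I := fun F => hI.conjFn_mem hf _
  refine hI.2.2.2.2.2.mem_of_tendsto (l := atTop) hmem (fun F => hI.1 (hmem F))
    (hf1.indicator _) fun φ hφ => ?_
  have hreindex : ∀ F, ∑' t, φ t * conjFn (s F) f t =
      ∑' u, φ (s F * u * (s F)⁻¹) * f u := fun F => by
    rw [← (MulAut.conj (s F)).toEquiv.tsum_eq]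
    refine tsum_congr fun u => ?_
    simp [conjFn, mul_assoc]
  simp_rw [hreindex]
  obtain ⟨C, hC⟩ := hφ.exists_bound
  refine tendsto_tsum_of_dominated_convergence (bound := fun u => C * ‖f u‖)
    (Summable.mul_left C hf1) (fun u => ?_) (Eventually.of_forall fun F u => ?_)
  · by_cases hu : u ∈ FCset G
    · rw [Set.indicator_of_mem hu]
      refine tendsto_const_nhds.congr' ?_
      filter_upwards [eventually_ge_atTop {u}] with F hF
      rw [(hs F u (Finset.singleton_subset_iff.mp hF)).1 hu]
    · rw [Set.indicator_of_notMem hu, mul_zero]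
      have hesc : Tendsto (fun F => s F * u * (s F)⁻¹) atTop cofinite := by
        refine le_cofinite_iff_eventually_ne.mpr fun x => ?_
        rw [eventually_map]
        filter_upwards [eventually_ge_atTop {u, x}] with F hF
        have hF' : u ∈ F ∧ x ∈ F := ⟨hF (by simp), hF (by simp)⟩
        exact fun h => (hs F u hF'.1).2 hu (h ▸ hF'.2)
      simpa using (Tendsto.comp hφ hesc).mul_const (f u)
  · rw [norm_mul]
    exact mul_le_mul_of_nonneg_right (hC _) (norm_nonneg _)

/-- A function all of whose coset components lie in a weak*-closed ideal lies in it. -/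
theorem IsWStarClosedIdeal.mem_of_forall_indicator_mem (hI : IsWStarClosedIdeal I)
    {N T : Set G} (hT : IsTransversal N T) {f : G → ℂ} (hf : MemL1 f)
    (h : ∀ t ∈ T, N.indicator (convFn (delta t⁻¹) f) ∈ I) : f ∈ I := by
  obtain ⟨hI1, hI0, hadd, -, hmul, hcl⟩ := hI
  choose r hr hruniq using hT
  have hmem : ∀ A : Finset G, {x | r x ∈ A}.indicator f ∈ I := by
    intro A
    induction A using Finset.induction_on with
    | empty =>
      convert hI0 using 1
      ext x
      simp
    | insert t A htA ih =>
      by_cases ht : t ∈ T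
      · convert hadd _ (hmul _ (h t ht) _ (memL1_delta t)).1 _ ih using 1
        ext x
        have hx : t⁻¹ * x ∈ N ↔ r x = t :=
          ⟨fun hx => (hruniq x t ⟨ht, hx⟩).symm, fun hx => hx ▸ (hr x).2⟩
        by_cases hxt : r x = t
        · simp [convFn_delta_left, Set.indicator_apply, hx, hxt, htA]
        · simp [convFn_delta_left, Set.indicator_apply, hx, hxt]
      · convert ih using 2
        ext x
        have : r x ≠ t := fun hx => ht (hx ▸ (hr x).1)
        simp [this]
  refine hcl.mem_of_tendsto (l := atTop) hmem (fun A => hI1 (hmem A)) hf fun φ hφ => ?_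
  obtain ⟨C, hC⟩ := hφ.exists_bound
  refine tendsto_tsum_of_dominated_convergence (bound := fun u => C * ‖f u‖)
    (Summable.mul_left C hf) (fun x => ?_) (Eventually.of_forall fun A x => ?_)
  · refine tendsto_const_nhds.congr' ?_
    filter_upwards [eventually_ge_atTop {r x}] with A hA
    have hx : x ∈ {x | r x ∈ A} := Finset.singleton_subset_iff.mp hA
    rw [Set.indicator_of_mem hx]
  · rw [norm_mul]
    exact mul_le_mul (hC _) (norm_indicator_le_norm_self f x) (norm_nonneg _)
      ((norm_nonneg _).trans (hC x))

end Ideal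

/-- **Proposition 5.7.** Let `T` be a transversal for `FC(G)` in `G`, let `I` be a
weak*-closed two-sided ideal of `ℓ¹(G)`, and set `J = I ∩ ℓ¹(FC(G))`. Then `J` is a
weak*-closed two-sided ideal of `ℓ¹(FC(G))` invariant under conjugation by `G`, and
`I = ⊕_{t∈T} δ_t * J`. -/
theorem weakStarClosed_ideal_determined_by_FC (G : Type*) [Group G] (T : Set G)
    (hT : IsTransversal (FCset G) T) (I : Set (G → ℂ)) (hI : IsWStarClosedIdeal I) :
    IsIdealOn (FCset G) (I ∩ L1On (FCset G)) ∧
      WStarClosed (I ∩ L1On (FCset G)) ∧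
      GConjInvariant (I ∩ L1On (FCset G)) ∧
      I = bigOplus (FCset G) T (I ∩ L1On (FCset G)) := by
  obtain ⟨hI1, hI0, hadd, hsmul, hmul, hcl⟩ := id hI
  have hconj : ∀ s : G, ∀ f ∈ I ∩ L1On (FCset G), conjFn s f ∈ I ∩ L1On (FCset G) := by
    refine fun s f hf => ⟨hI.conjFn_mem hf.1 s, hI1 (hI.conjFn_mem hf.1 s), fun x hx => ?_⟩
    refine hf.2.2 _ fun h => hx ?_
    simpa [mul_assoc] using conj_mem_FCset h s
  refine ⟨⟨Set.inter_subset_right, ⟨hI0, hI1 hI0, fun _ _ => rfl⟩, fun f hf g hg => ?_,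
    fun c f hf => ?_, fun f hf g hg => ⟨?_, ?_⟩⟩, hcl.inter_L1On _, fun s => ?_, ?_⟩
  · have h := hadd f hf.1 g hg.1
    exact ⟨h, hI1 h, fun x hx => by simp [hf.2.2 x hx, hg.2.2 x hx]⟩
  · have h := hsmul c f hf.1
    exact ⟨h, hI1 h, fun x hx => by simp [hf.2.2 x hx]⟩
  · have h := (hmul f hf.1 g hg.1).1
    exact ⟨h, hI1 h, SuppIn.convFn (N := fcCentre G) hg.2 hf.2.2⟩
  · have h := (hmul f hf.1 g hg.1).2
    exact ⟨h, hI1 h, SuppIn.convFn (N := fcCentre G) hf.2.2 hg.2⟩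
  · refine Set.Subset.antisymm (Set.image_subset_iff.mpr (hconj s)) fun f hf => ?_
    refine ⟨conjFn s⁻¹ f, hconj s⁻¹ f hf, ?_⟩
    ext x
    simp [conjFn, mul_assoc]
  · refine Set.Subset.antisymm (fun f hf => ⟨hI1 hf, fun t _ => ?_⟩) fun f hf =>
      hI.mem_of_forall_indicator_mem hT hf.1 fun t ht => (hf.2 t ht).1
    have h := hI.indicator_FCset_mem (hmul f hf _ (memL1_delta t⁻¹)).1
    exact ⟨h, hI1 h, fun x hx => Set.indicator_of_notMem hx _⟩
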